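/- arXiv:2310.12386 — 3 statements merged into one kernel-verified Lean document; each statement's English description precedes it below -/
import Mathlib

section
/- Let ι be a finite type, S : ι → Type a family of state spaces, prec a relation on ι, and u a family of update functions that is local with respect to prec. If i ≠ j, ¬ prec i j and ¬ prec j i, then the step functions of i and j commute: for every global state x, step i (step j x) = step j (step i x). -/
/-- A family of update functions is local w.r.t. `prec`: the update of node `i`
depends only on the components `x j` with `prec j i`. -/
def IsLocal {ι : Type*} {S : ι → Type*} (prec : ι → ι → Prop)
    (u : ∀ i, (∀ j, S j) → S i) : Prop :=
  ∀ i (x y : ∀ j, S j), (∀ j, prec j i → x j = y j) → u i x = u i y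

/-- The step function of node `i`: replace the `i`-th component of the global
state by `u i x`, leaving all other components unchanged. -/
def step {ι : Type*} [DecidableEq ι] {S : ι → Type*}
    (u : ∀ i, (∀ j, S j) → S i) (i : ι) (x : ∀ j, S j) : ∀ j, S j :=
  Function.update x i (u i x)

/-- A local update of node `i` is unaffected by a step of a node that `i` does not
depend on. -/
theorem IsLocal.apply_step {ι : Type*} [DecidableEq ι] {S : ι → Type*}
    {prec : ι → ι → Prop} {u : ∀ i, (∀ j, S j) → S i} (hloc : IsLocal prec u)
    {i j : ι} (hji : ¬ prec j i) (x : ∀ k, S k) : u i (step u j x) = u i x :=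
  hloc i _ _ fun k hk => Function.update_of_ne (fun h : k = j => hji (h ▸ hk)) _ _

/-- If `i ≠ j` and `i`, `j` are unrelated by `prec`, then their step functions
commute. -/
theorem step_comm {ι : Type*} [Fintype ι] [DecidableEq ι] {S : ι → Type*}
    (prec : ι → ι → Prop) (u : ∀ i, (∀ j, S j) → S i)
    (hloc : IsLocal prec u) (i j : ι) (hij : i ≠ j)
    (hij' : ¬ prec i j) (hji : ¬ prec j i) (x : ∀ k, S k) :
    step u i (step u j x) = step u j (step u i x) := by
  rw [step, step.eq_def u j (step u i x), hloc.apply_step hji, hloc.apply_step hij']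
  exact Function.update_comm hij.symm _ _ x
end

section
/- Let α be a finite type equipped with a partial order. Any two linear extensions of the partial order, viewed as lists enumerating every element of α exactly once in which a occurs before b whenever a < b, can be transformed into one another by a finite sequence of transpositions of adjacent list entries, where each transposition swaps two elements that are incomparable in the partial order, and every intermediate list in the sequence is again a linear extension. -/
/-- A list `ℓ` over a finite partially ordered type `α` is a linear extension:
it contains every element of `α` exactly once, and whenever `a < b`, `a`
occurs before `b` in `ℓ`. -/
def IsLinExt {α : Type*} [Fintype α] [PartialOrder α] [DecidableEq α]
    (ℓ : List α) : Prop :=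
  (∀ a : α, ℓ.count a = 1) ∧ ∀ a b : α, a < b → [a, b].Sublist ℓ

/-- `ℓ'` is obtained from `ℓ` by transposing two adjacent entries that are
incomparable in the partial order. -/
def AdjIncompSwap {α : Type*} [PartialOrder α] (ℓ ℓ' : List α) : Prop :=
  ∃ (l₁ l₂ : List α) (a b : α), ¬ a ≤ b ∧ ¬ b ≤ a ∧
    ℓ = l₁ ++ a :: b :: l₂ ∧ ℓ' = l₁ ++ b :: a :: l₂

theorem List.Nodup.not_pair_sublist_swap {α : Type*} {ℓ : List α} (h : ℓ.Nodup) {a b : α}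
    (hab : [a, b].Sublist ℓ) : ¬ [b, a].Sublist ℓ := by
  induction ℓ with
  | nil => simp at hab
  | cons c t ih =>
    have hc := (List.nodup_cons.mp h).1
    intro hba
    rcases List.sublist_cons_iff.mp hab with h₁ | ⟨r, hr, h₁⟩ <;>
      rcases List.sublist_cons_iff.mp hba with h₂ | ⟨s, hs, h₂⟩
    · exact ih (List.nodup_cons.mp h).2 h₁ h₂
    · have := h₁.subset
      grind
    · have := h₂.subset
      grind
    · have := h₁.subset
      grind

theorem isLinExt_iff_pairwise {α : Type*} [Fintype α] [PartialOrder α] [DecidableEq α]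
    {ℓ : List α} :
    IsLinExt ℓ ↔ (∀ a : α, ℓ.count a = 1) ∧ ℓ.Pairwise fun a b => ¬ b < a := by
  refine and_congr_right fun hc => ⟨fun h => ?_, fun h a b hab => ?_⟩
  · have hn : ℓ.Nodup := List.nodup_iff_count_le_one.mpr fun a => (hc a).le
    exact List.pairwise_iff_forall_sublist.mpr fun hab hlt =>
      hn.not_pair_sublist_swap hab (h _ _ hlt)
  · have hmem : ∀ x, x ∈ ℓ := fun x => List.count_pos_iff.mp (by simp [hc x])
    obtain ⟨s, t, rfl⟩ := List.append_of_mem (hmem a)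
    have hb : b ∈ t := by
      have := hmem b
      have := hab.ne'
      have := List.pairwise_append.mp h
      grind
    exact (List.Sublist.cons_cons a (List.singleton_sublist.mpr hb)).trans
      (List.sublist_append_right s _)

theorem AdjIncompSwap.isLinExt {α : Type*} [Fintype α] [PartialOrder α] [DecidableEq α]
    {ℓ ℓ' : List α} (hs : AdjIncompSwap ℓ ℓ') (h : IsLinExt ℓ) : IsLinExt ℓ' := by
  obtain ⟨l₁, l₂, a, b, hab, hba, rfl, rfl⟩ := hs
  rw [isLinExt_iff_pairwise] at h ⊢
  refine ⟨fun x => ?_, ?_⟩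
  · rw [← h.1 x]
    exact ((List.Perm.swap a b l₂).append_left l₁).count_eq x
  · have hlt : ¬ a < b := fun h => hab h.le
    have := h.2
    simp only [List.pairwise_append, List.pairwise_cons, List.mem_cons] at this ⊢
    grind

theorem AdjIncompSwap.cons {α : Type*} [PartialOrder α] {ℓ ℓ' : List α} (c : α)
    (hs : AdjIncompSwap ℓ ℓ') : AdjIncompSwap (c :: ℓ) (c :: ℓ') := by
  obtain ⟨l₁, l₂, a, b, hab, hba, rfl, rfl⟩ := hs
  exact ⟨c :: l₁, l₂, a, b, hab, hba, rfl, rfl⟩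

theorem reflTransGen_adjIncompSwap_move_to_front {α : Type*} [PartialOrder α] {b : α}
    {l₁ : List α} (l₂ : List α) (h : ∀ x ∈ l₁, ¬ x ≤ b ∧ ¬ b ≤ x) :
    Relation.ReflTransGen AdjIncompSwap (l₁ ++ b :: l₂) (b :: (l₁ ++ l₂)) := by
  induction l₁ with
  | nil => exact .refl
  | cons c t ih =>
    have hc := h c List.mem_cons_self
    exact ((ih fun x hx => h x (List.mem_cons_of_mem c hx)).lift (List.cons c)
      fun _ _ => AdjIncompSwap.cons c).tail
      ⟨[], t ++ l₂, c, b, hc.1, hc.2, rfl, rfl⟩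

theorem List.Perm.reflTransGen_adjIncompSwap {α : Type*} [PartialOrder α] {ℓ₁ ℓ₂ : List α}
    (hp : ℓ₁.Perm ℓ₂) (hn : ℓ₂.Nodup) (h₁ : ℓ₁.Pairwise fun a b => ¬ b < a)
    (h₂ : ℓ₂.Pairwise fun a b => ¬ b < a) :
    Relation.ReflTransGen AdjIncompSwap ℓ₁ ℓ₂ := by
  induction ℓ₂ generalizing ℓ₁ with
  | nil => rw [hp.eq_nil]
  | cons b t ih =>
    obtain ⟨l₁, l₂, rfl⟩ := List.append_of_mem (hp.mem_iff.mpr List.mem_cons_self)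
    have hp' : (l₁ ++ l₂).Perm t := (List.perm_middle.symm.trans hp).cons_inv
    rw [List.nodup_cons] at hn
    rw [List.pairwise_cons] at h₂
    have hinc : ∀ x ∈ l₁, ¬ x ≤ b ∧ ¬ b ≤ x := by
      intro x hx
      have hxt : x ∈ t := hp'.subset (List.mem_append_left l₂ hx)
      have hxb : x ≠ b := fun h => hn.1 (h ▸ hxt)
      exact ⟨fun h => h₂.1 x hxt (h.lt_of_ne hxb),
        fun h => (List.pairwise_append.mp h₁).2.2 x hx b List.mem_cons_self
          (h.lt_of_ne hxb.symm)⟩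
    have hsub : (l₁ ++ l₂).Sublist (l₁ ++ b :: l₂) := (List.sublist_cons_self b l₂).append_left l₁
    exact (reflTransGen_adjIncompSwap_move_to_front l₂ hinc).trans
      ((ih hp' hn.2 (h₁.sublist hsub) h₂.2).lift (List.cons b) fun _ _ => AdjIncompSwap.cons b)

/-- Any two linear extensions of a finite partial order are connected by a
finite sequence of adjacent transpositions of incomparable elements, all of
whose intermediate lists are again linear extensions. -/
theorem linext_connected_by_adjacent_swaps {α : Type*} [Fintype α]
    [PartialOrder α] [DecidableEq α] (ℓ₁ ℓ₂ : List α)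
    (h₁ : IsLinExt ℓ₁) (h₂ : IsLinExt ℓ₂) :
    Relation.ReflTransGen
      (fun ℓ ℓ' => IsLinExt ℓ ∧ IsLinExt ℓ' ∧ AdjIncompSwap ℓ ℓ') ℓ₁ ℓ₂ := by
  have hg : Relation.ReflTransGen AdjIncompSwap ℓ₁ ℓ₂ :=
    (List.perm_iff_count.mpr fun a => by rw [h₁.1 a, h₂.1 a]).reflTransGen_adjIncompSwap
      (List.nodup_iff_count_le_one.mpr fun a => (h₂.1 a).le)
      (isLinExt_iff_pairwise.mp h₁).2 (isLinExt_iff_pairwise.mp h₂).2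
  induction hg using Relation.ReflTransGen.head_induction_on with
  | refl => exact .refl
  | head hs _ ih => exact .head ⟨h₁, hs.isLinExt h₁, hs⟩ (ih (hs.isLinExt h₁))
end

section
/- Let ι be a finite type, S : ι → Type a family of nonempty state spaces, prec a relation on ι whose transitive closure is irreflexive, and u a family of update functions such that for every i, u i x depends only on the components x j with prec j i (i.e., for all global states x y agreeing on every j with prec j i, u i x = u i y). Then there exists a unique global state x* such that x* i = u i x* for every i. -/
open Classical in
/-- The global state obtained by propagating updates along a well-founded dependency relation,
filling the components on which the update of a node does not depend with arbitrary values. -/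
noncomputable def propagate {ι : Type*} {S : ι → Type*} [∀ i, Nonempty (S i)]
    {prec : ι → ι → Prop} (hwf : WellFounded prec) (u : ∀ i, (∀ j, S j) → S i) : ∀ i, S i :=
  hwf.fix fun i ih => u i fun j => if h : prec j i then ih j h else Classical.arbitrary (S j)

theorem wellFounded_of_irrefl_transGen {ι : Type*} [Finite ι] (prec : ι → ι → Prop)
    [Std.Irrefl (Relation.TransGen prec)] : WellFounded prec :=
  Subrelation.wf Relation.TransGen.single
    (Finite.wellFounded_of_trans_of_irrefl (Relation.TransGen prec))

theorem IsLocal.propagate_eq {ι : Type*} {S : ι → Type*} [∀ i, Nonempty (S i)]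
    {prec : ι → ι → Prop} {u : ∀ i, (∀ j, S j) → S i} (hloc : IsLocal prec u)
    (hwf : WellFounded prec) (i : ι) : propagate hwf u i = u i (propagate hwf u) := by
  refine (hwf.fix_eq _ i).trans (hloc i _ _ fun j hj => ?_)
  rw [dif_pos hj]
  rfl

theorem IsLocal.eq_of_fixed {ι : Type*} {S : ι → Type*} {prec : ι → ι → Prop}
    {u : ∀ i, (∀ j, S j) → S i} (hloc : IsLocal prec u) (hwf : WellFounded prec)
    {x y : ∀ j, S j} (hx : ∀ i, x i = u i x) (hy : ∀ i, y i = u i y) : x = y := by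
  funext i
  induction i using hwf.induction with
  | _ i ih => rw [hx i, hy i, hloc i x y ih]

/-- Over a DAG of dependencies, a local family of update functions has a
unique self-consistent global state. -/
theorem existsUnique_fixed_point {ι : Type*} [Fintype ι] {S : ι → Type*}
    [∀ i, Nonempty (S i)] (prec : ι → ι → Prop)
    (hdag : Irreflexive (Relation.TransGen prec))
    (u : ∀ i, (∀ j, S j) → S i) (hloc : IsLocal prec u) :
    ∃! x : ∀ j, S j, ∀ i, x i = u i x := by
  have : Std.Irrefl (Relation.TransGen prec) := ⟨hdag⟩
  have hwf := wellFounded_of_irrefl_transGen prec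
  exact ⟨propagate hwf u, hloc.propagate_eq hwf,
    fun _ hy => hloc.eq_of_fixed hwf hy (hloc.propagate_eq hwf)⟩
end
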